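/- arXiv:1802.10213 — 5 statements merged into one kernel-verified Lean document; each statement's English description precedes it below -/
import Mathlib

section
/- (Matkowski fixed point theorem) Let (X,d) be a complete metric space and T : X → X a generalized Matkowski contraction, i.e. there exists a non-decreasing function φ : [0,∞) → [0,∞) with φ^n(t) → 0 as n → ∞ for every t ≥ 0 and d(T(x),T(y)) ≤ φ(d(x,y)) for all x, y ∈ X. Then there exists a unique x₀ ∈ X with T(x₀) = x₀, and d(T^n(x), x₀) → 0 as n → ∞ for every x ∈ X. -/
open Filter Topology

/-- **Matkowski fixed point theorem.** Let `(X,d)` be a complete metric space and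
`T : X → X` a generalized Matkowski contraction: there is a non-decreasing function
`φ : [0,∞) → [0,∞)` with `φ^[n] t → 0` for every `t ≥ 0` and `d(T x, T y) ≤ φ (d x y)` for all
`x, y`.  Then `T` has a unique fixed point `x₀`, and `d(T^[n] x, x₀) → 0` for every `x`. -/
theorem matkowski_fixed_point
    {X : Type*} [MetricSpace X] [CompleteSpace X] [Nonempty X]
    (T : X → X) (φ : ℝ → ℝ)
    (hφmono : MonotoneOn φ (Set.Ici 0))
    (hφnonneg : ∀ t, 0 ≤ t → 0 ≤ φ t)
    (hφiter : ∀ t, 0 ≤ t → Tendsto (fun n => φ^[n] t) atTop (𝓝 0))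
    (hT : ∀ x y, dist (T x) (T y) ≤ φ (dist x y)) :
    ∃ x₀, T x₀ = x₀ ∧ (∀ y, T y = y → y = x₀) ∧
      ∀ x, Tendsto (fun n => dist (T^[n] x) x₀) atTop (𝓝 0) := by
  have hlt : ∀ t, 0 < t → φ t < t := by
    intro t ht
    by_contra! h
    have key : ∀ n, t ≤ φ^[n] t := by
      intro n
      induction n with
      | zero => simp
      | succ k ih =>
        rw [Function.iterate_succ_apply']
        exact h.trans (hφmono ht.le (ht.le.trans ih) ih)
    have := ge_of_tendsto' (hφiter t ht.le) key
    linarith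
  have h0 : φ 0 ≤ 0 := by
    by_contra! h
    have h1 := hlt _ h
    have h2 := hφmono (Set.mem_Ici.2 le_rfl) (Set.mem_Ici.2 h.le) h.le
    linarith
  have hle : ∀ t, 0 ≤ t → φ t ≤ t := by
    intro t ht
    rcases ht.eq_or_lt with h | h
    · rw [← h]; exact h0
    · exact (hlt t h).le
  have hiter : ∀ x y n, dist (T^[n] x) (T^[n] y) ≤ φ^[n] (dist x y) := by
    intro x y n
    induction n with
    | zero => simp
    | succ k ih =>
      simp only [Function.iterate_succ_apply']
      exact (hT _ _).trans (hφmono dist_nonneg (dist_nonneg.trans ih) ih)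
  have hconv : ∀ x y, Tendsto (fun n => dist (T^[n] x) (T^[n] y)) atTop (𝓝 0) := fun x y =>
    squeeze_zero (fun _ => dist_nonneg) (hiter x y) (hφiter _ dist_nonneg)
  have hcont : Continuous T := by
    refine (LipschitzWith.of_dist_le_mul (K := 1) fun x y => ?_).continuous
    simpa using (hT x y).trans (hle _ dist_nonneg)
  obtain ⟨x⟩ := ‹Nonempty X›
  have hc : CauchySeq (fun n => T^[n] x) := by
    rw [Metric.cauchySeq_iff']
    intro ε hε
    have he : 0 < ε / 2 := by positivity
    have hd := hlt _ he
    obtain ⟨N, hN⟩ := ((hconv x (T x)).eventually (gt_mem_nhds (sub_pos.2 hd))).exists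
    rw [← Function.iterate_succ_apply, Function.iterate_succ_apply'] at hN
    have key : ∀ k, dist (T^[N + k] x) (T^[N] x) ≤ ε / 2 := by
      intro k
      induction k with
      | zero => simpa using he.le
      | succ k ih =>
        rw [← add_assoc, Function.iterate_succ_apply']
        have h1 := dist_triangle (T (T^[N + k] x)) (T (T^[N] x)) (T^[N] x)
        have h2 := hT (T^[N + k] x) (T^[N] x)
        have h3 := hφmono (Set.mem_Ici.2 dist_nonneg) (Set.mem_Ici.2 he.le) ih
        rw [dist_comm (T (T^[N] x)) (T^[N] x)] at h1
        linarith
    refine ⟨N, fun n hn => ?_⟩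
    obtain ⟨k, rfl⟩ := Nat.exists_eq_add_of_le hn
    have := key k
    linarith
  obtain ⟨x₀, hx₀⟩ := cauchySeq_tendsto_of_complete hc
  have hfix : T x₀ = x₀ := isFixedPt_of_tendsto_iterate hx₀ hcont.continuousAt
  have hlim : ∀ x, Tendsto (fun n => dist (T^[n] x) x₀) atTop (𝓝 0) := by
    intro y
    have := hconv y x₀
    simpa only [Function.iterate_fixed hfix] using this
  refine ⟨x₀, hfix, fun y hy => ?_, hlim⟩
  have := hlim y
  simp only [Function.iterate_fixed hy] at this
  exact dist_eq_zero.1 (tendsto_nhds_unique tendsto_const_nhds this)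
end

section
/- Let u be nonnegative, bounded and continuous and δ : [0,∞) → [0,∞) a variable discount function with δ(0) = 0 and generalized modulus of contraction γ. If U : Ω → [0,∞) is a bounded function satisfying the recursive utility equation U(h_x(ā)) = u(x₀,a₀) + δ(U(h_{x₁}(σā))) for every feasible history (where σ is the left shift on action sequences), then for every feasible history the partial star-sums converge to U: |∑*_{i∈[n]} u(x_i,a_i) − U(h_x(ā))| ≤ γ^n(K) → 0 for any bound K ≥ sup U; hence U(h_x(ā)) = ∑*_i u(x_i,a_i). -/
open Filter Topology

/-- A history `ω = (x₀,a₀,x₁,a₁,…) ∈ (X × A)^ℕ` is feasible when `a_i ∈ Ψ(x_i)` and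
`x_{i+1} = f(x_i,a_i)` for every `i`. -/
def Feasible {X A : Type*} (Ψ : X → Set A) (f : X × A → X) (ω : ℕ → X × A) : Prop :=
  ∀ i, (ω i).2 ∈ Ψ (ω i).1 ∧ (ω (i + 1)).1 = f (ω i)

/-- The partial star-sum `∑*_{i∈[n]} c_i = c₀ + δ(c₁ + δ(c₂ + ⋯ + δ(c_n)⋯))`. -/
noncomputable def starSum (δ : ℝ → ℝ) : (ℕ → ℝ) → ℕ → ℝ
  | c, 0 => c 0
  | c, n + 1 => c 0 + δ (starSum δ (fun i => c (i + 1)) n)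

/-- Let `u` be nonnegative, bounded and continuous and `δ` a variable discount
function with `δ(0) = 0` and generalized modulus of contraction `γ`.  If `U` is a bounded
nonnegative function on feasible histories satisfying the recursive utility equation
`U(h_x(ā)) = u(x₀,a₀) + δ(U(h_{x₁}(σā)))`, then for every feasible history the partial
star-sums converge to `U`:  `|∑*_{i∈[n]} u(x_i,a_i) − U(h_x(ā))| ≤ γ^[n] K → 0` for any bound
`K ≥ sup U`; hence `U(h_x(ā)) = ∑*_i u(x_i,a_i)`. -/
theorem recursive_utility_is_star_sum
    {X A : Type*} [MetricSpace X] [CompleteSpace X] [MetricSpace A]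
    (Ψ : X → Set A) (f : X × A → X) (u : X × A → ℝ) (δ γ : ℝ → ℝ)
    (hΨc : ∀ x, IsCompact (Ψ x)) (hΨne : ∀ x, (Ψ x).Nonempty)
    (hΨcont : Continuous fun x =>
      (⟨⟨Ψ x, hΨc x⟩, hΨne x⟩ : TopologicalSpace.NonemptyCompacts A))
    (hf : Continuous f) (hu : Continuous u)
    (hunn : ∀ p, 0 ≤ u p) (hub : ∃ C, ∀ p, u p ≤ C)
    -- `δ` is a variable discount function with `δ 0 = 0`:
    (hδcont : ContinuousOn δ (Set.Ici 0)) (hδmono : MonotoneOn δ (Set.Ici 0))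
    (hδnn : ∀ t, 0 ≤ t → 0 ≤ δ t) (hδ0 : δ 0 = 0)
    -- `γ` is a generalized modulus of contraction for `δ`:
    (hγmono : MonotoneOn γ (Set.Ici 0)) (hγnn : ∀ t, 0 ≤ t → 0 ≤ γ t)
    (hγiter : ∀ t, 0 ≤ t → Tendsto (fun n => γ^[n] t) atTop (𝓝 0))
    (hγδ : ∀ s t, 0 ≤ s → 0 ≤ t → |δ s - δ t| ≤ γ |s - t|)
    -- `U` is a bounded recursive utility with values in `[0,∞)`:
    (U : (ℕ → X × A) → ℝ)
    (hUnn : ∀ ω, Feasible Ψ f ω → 0 ≤ U ω)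
    (hrec : ∀ ω, Feasible Ψ f ω → U ω = u (ω 0) + δ (U fun i => ω (i + 1)))
    (K : ℝ) (hK : ∀ ω, Feasible Ψ f ω → U ω ≤ K) :
    ∀ ω, Feasible Ψ f ω →
      (∀ n, |starSum δ (fun i => u (ω i)) n - U ω| ≤ γ^[n] K) ∧
      Tendsto (fun n => γ^[n] K) atTop (𝓝 0) ∧
      Tendsto (fun n => starSum δ (fun i => u (ω i)) n) atTop (𝓝 (U ω)) := by
  have hsh : ∀ ω, Feasible Ψ f ω → Feasible Ψ f (fun i => ω (i + 1)) :=
    fun ω h i => h (i + 1)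
  have hSnn : ∀ (n : ℕ) (c : ℕ → ℝ), (∀ i, 0 ≤ c i) → 0 ≤ starSum δ c n := by
    intro n
    induction n with
    | zero => intro c hc; simpa [starSum] using hc 0
    | succ n ih =>
      intro c hc
      rw [starSum]
      exact add_nonneg (hc 0) (hδnn _ (ih _ fun i => hc (i + 1)))
  have key : ∀ (n : ℕ) (ω : ℕ → X × A), Feasible Ψ f ω →
      |starSum δ (fun i => u (ω i)) n - U ω| ≤ γ^[n] K := by
    intro n
    induction n with
    | zero =>
      intro ω h
      have h1 := hrec ω h
      have h2 := hδnn _ (hUnn _ (hsh ω h))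
      have h3 := hK ω h
      have h4 := hunn (ω 0)
      simp only [starSum, Function.iterate_zero, id]
      rw [abs_le]
      constructor <;> linarith
    | succ n ih =>
      intro ω h
      have h1 := hrec ω h
      have h2 := ih _ (hsh ω h)
      have h3 := hγδ _ _ (hSnn n (fun i => u (ω (i + 1))) fun i => hunn _) (hUnn _ (hsh ω h))
      rw [Function.iterate_succ_apply', starSum, h1, add_sub_add_left_eq_sub]
      exact h3.trans (hγmono (Set.mem_Ici.2 (abs_nonneg _)) (Set.mem_Ici.2 ((abs_nonneg _).trans h2)) h2)
  intro ω h
  have hT := hγiter K ((hUnn ω h).trans (hK ω h))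
  refine ⟨fun n => key n ω h, hT, ?_⟩
  rw [tendsto_iff_dist_tendsto_zero]
  exact squeeze_zero (fun _ => dist_nonneg) (fun n => key n ω h) hT
end

section
/- Let u be nonnegative, bounded and continuous and δ : [0,∞) → [0,∞) a variable discount function with δ(0) = 0. Then: (i) for every bounded continuous v : X → [0,∞), the function B(v)(x) = sup_{a ∈ Ψ(x)} [u(x,a) + δ(v(f(x,a)))] is bounded and continuous on X; (ii) if in addition the family (ν_x) depends weak-* continuously on x, then P(v)(x) = ln ∫_{Ψ(x)} exp(u(x,a) + δ(v(f(x,a)))) dν_x(a) is bounded and continuous on X. -/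
open Filter Topology MeasureTheory

theorem aux_unif {X A : Type*} [MetricSpace X] [MetricSpace A]
    (Ψ : X → Set A)
    (hΨc : ∀ x, IsCompact (Ψ x)) (hΨne : ∀ x, (Ψ x).Nonempty)
    (hΨcont : Continuous fun x =>
      (⟨⟨Ψ x, hΨc x⟩, hΨne x⟩ : TopologicalSpace.NonemptyCompacts A))
    (G : X × A → ℝ) (hG : Continuous G) (x0 : X) (ε : ℝ) (hε : 0 < ε) :
    ∀ᶠ x in 𝓝 x0,
      (∀ a ∈ Ψ x, ∃ b ∈ Ψ x0, |G (x, a) - G (x0, b)| < ε ∧ |G (x0, a) - G (x0, b)| < ε) ∧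
      (∀ b ∈ Ψ x0, ∃ a ∈ Ψ x, |G (x, a) - G (x0, b)| < ε) := by
  have hK : IsCompact (({x0} : Set X) ×ˢ Ψ x0) := isCompact_singleton.prod (hΨc x0)
  have h1 := hK.uniformContinuousAt_of_continuousAt G (fun a _ => hG.continuousAt)
    (Metric.dist_mem_uniformity hε)
  obtain ⟨η, hη, h2⟩ := Metric.mem_uniformity_dist.1 h1
  have key : ∀ x a b, dist x x0 < η → b ∈ Ψ x0 → dist a b < η →
      |G (x, a) - G (x0, b)| < ε := by
    intro x a b hx hb hab
    have := h2 (a := (x0, b)) (b := (x, a))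
      (by rw [Prod.dist_eq, max_lt_iff, dist_comm x0, dist_comm b]; exact ⟨hx, hab⟩)
    have := this ⟨rfl, hb⟩
    rw [← Real.dist_eq, dist_comm]
    exact this
  have h3 := Metric.tendsto_nhds.1 (hΨcont.tendsto x0) η hη
  filter_upwards [h3, Metric.ball_mem_nhds x0 hη] with x hx hxx
  have hfin : Metric.hausdorffEDist (Ψ x) (Ψ x0) ≠ ⊤ :=
    Metric.hausdorffEDist_ne_top_of_nonempty_of_bounded (hΨne x) (hΨne x0)
      (hΨc x).isBounded (hΨc x0).isBounded
  have hx' : Metric.hausdorffDist (Ψ x) (Ψ x0) < η := hx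
  refine ⟨fun a ha => ?_, fun b hb => ?_⟩
  · obtain ⟨b, hb, hab⟩ := Metric.exists_dist_lt_of_hausdorffDist_lt ha hx' hfin
    exact ⟨b, hb, key x a b hxx hb hab, key x0 a b (by simpa using hη) hb hab⟩
  · obtain ⟨a, ha, hab⟩ := Metric.exists_dist_lt_of_hausdorffDist_lt' hb hx' hfin
    exact ⟨a, ha, key x a b hxx hb hab⟩

theorem aux_sup {X A : Type*} [MetricSpace X] [MetricSpace A]
    (Ψ : X → Set A)
    (hΨc : ∀ x, IsCompact (Ψ x)) (hΨne : ∀ x, (Ψ x).Nonempty)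
    (hΨcont : Continuous fun x =>
      (⟨⟨Ψ x, hΨc x⟩, hΨne x⟩ : TopologicalSpace.NonemptyCompacts A))
    (G : X × A → ℝ) (hG : Continuous G) (M : ℝ) (hM : ∀ p, G p ≤ M) :
    Continuous (fun x => sSup ((fun a => G (x, a)) '' Ψ x)) := by
  have hbdd : ∀ x, BddAbove ((fun a => G (x, a)) '' Ψ x) := by
    rintro x
    exact ⟨M, by rintro _ ⟨a, _, rfl⟩; exact hM _⟩
  rw [continuous_iff_continuousAt]
  intro x0
  refine Metric.tendsto_nhds.2 fun ε hε => ?_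
  filter_upwards [aux_unif Ψ hΨc hΨne hΨcont G hG x0 (ε / 2) (half_pos hε)] with x hx
  have h1 : sSup ((fun a => G (x, a)) '' Ψ x) ≤ sSup ((fun a => G (x0, a)) '' Ψ x0) + ε / 2 := by
    apply csSup_le ((hΨne x).image _)
    rintro _ ⟨a, ha, rfl⟩
    obtain ⟨b, hb, hab, -⟩ := hx.1 a ha
    have := le_csSup (hbdd x0) (Set.mem_image_of_mem _ hb)
    have := (abs_lt.1 hab).2
    dsimp only at *
    linarith
  have h2 : sSup ((fun a => G (x0, a)) '' Ψ x0) ≤ sSup ((fun a => G (x, a)) '' Ψ x) + ε / 2 := by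
    apply csSup_le ((hΨne x0).image _)
    rintro _ ⟨b, hb, rfl⟩
    obtain ⟨a, ha, hab⟩ := hx.2 b hb
    have := le_csSup (hbdd x) (Set.mem_image_of_mem _ ha)
    have := (abs_lt.1 hab).1
    dsimp only at *
    linarith
  rw [Real.dist_eq, abs_lt]
  constructor <;> linarith

theorem aux_int {X A : Type*} [MetricSpace X] [MetricSpace A]
    [MeasurableSpace A] [BorelSpace A]
    (Ψ : X → Set A)
    (hΨc : ∀ x, IsCompact (Ψ x)) (hΨne : ∀ x, (Ψ x).Nonempty)
    (hΨcont : Continuous fun x =>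
      (⟨⟨Ψ x, hΨc x⟩, hΨne x⟩ : TopologicalSpace.NonemptyCompacts A))
    (G : X × A → ℝ) (hG : Continuous G) (M : ℝ) (hM : ∀ p, ‖G p‖ ≤ M)
    (ν : X → ProbabilityMeasure A)
    (hν1 : ∀ x, (ν x : Measure A) (Ψ x) = 1)
    (hνcont : Continuous ν) :
    Continuous (fun x => ∫ a, G (x, a) ∂(ν x : Measure A)) := by
  have hint : ∀ x y, Integrable (fun a => G (x, a)) (ν y : Measure A) := fun x y =>
    Integrable.of_bound (hG.comp (by fun_prop)).measurable.aestronglyMeasurable M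
      (Eventually.of_forall fun a => hM _)
  rw [continuous_iff_continuousAt]
  intro x0
  refine Metric.tendsto_nhds.2 fun ε hε => ?_
  let g : BoundedContinuousFunction A ℝ :=
    BoundedContinuousFunction.ofNormedAddCommGroup (fun a => G (x0, a))
      (hG.comp (by fun_prop)) M (fun a => hM _)
  have hw := (ProbabilityMeasure.tendsto_iff_forall_integral_tendsto.1 (hνcont.tendsto x0)) g
  have hw' := Metric.tendsto_nhds.1 hw (ε / 2) (half_pos hε)
  filter_upwards [hw', aux_unif Ψ hΨc hΨne hΨcont G hG x0 (ε / 8) (by linarith)] with x h1 hx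
  have h1' : |(∫ a, G (x0, a) ∂(ν x : Measure A)) - ∫ a, G (x0, a) ∂(ν x0 : Measure A)| < ε / 2 :=
    h1
  have hae : ∀ᵐ a ∂(ν x : Measure A), a ∈ Ψ x :=
    (prob_compl_eq_zero_iff (hΨc x).isClosed.measurableSet).2 (hν1 x)
  have h2 : ‖∫ a, (G (x, a) - G (x0, a)) ∂(ν x : Measure A)‖ ≤ ε / 4 := by
    have := norm_integral_le_of_norm_le_const (μ := (ν x : Measure A))
      (f := fun a => G (x, a) - G (x0, a)) (C := ε / 4) (by
        filter_upwards [hae] with a ha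
        obtain ⟨b, hb, h3, h4⟩ := hx.1 a ha
        rw [abs_lt] at h3 h4
        rw [Real.norm_eq_abs, abs_le]
        constructor <;> linarith)
    simpa using this
  rw [integral_sub (hint _ _) (hint _ _), Real.norm_eq_abs, abs_le] at h2
  rw [abs_lt] at h1'
  rw [Real.dist_eq, abs_lt]
  constructor <;> linarith

/-- Let `u` be nonnegative, bounded and continuous and `δ` a variable discount
function with `δ(0) = 0`.  Then: (i) for every bounded continuous `v : X → [0,∞)`, the Bellman
image `B(v)(x) = sup_{a ∈ Ψ(x)} [u(x,a) + δ(v(f(x,a)))]` is bounded and continuous on `X`;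
(ii) if the family `(ν_x)` of Borel probability measures (with `ν_x(Ψ(x)) = 1`) depends
weak-* continuously on `x`, then `P(v)(x) = ln ∫ exp(u(x,a) + δ(v(f(x,a)))) dν_x(a)` is
bounded and continuous on `X`. -/
theorem bellman_and_transfer_preserve_bounded_continuous
    {X A : Type*} [MetricSpace X] [CompleteSpace X] [MetricSpace A]
    [MeasurableSpace A] [BorelSpace A]
    (Ψ : X → Set A) (f : X × A → X) (u : X × A → ℝ) (δ γ : ℝ → ℝ)
    (hΨc : ∀ x, IsCompact (Ψ x)) (hΨne : ∀ x, (Ψ x).Nonempty)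
    (hΨcont : Continuous fun x =>
      (⟨⟨Ψ x, hΨc x⟩, hΨne x⟩ : TopologicalSpace.NonemptyCompacts A))
    (hf : Continuous f) (hu : Continuous u)
    (hunn : ∀ p, 0 ≤ u p) (hub : ∃ C, ∀ p, u p ≤ C)
    -- `δ` is a variable discount function with `δ 0 = 0` and modulus of contraction `γ`:
    (hδcont : ContinuousOn δ (Set.Ici 0)) (hδmono : MonotoneOn δ (Set.Ici 0))
    (hδnn : ∀ t, 0 ≤ t → 0 ≤ δ t) (hδ0 : δ 0 = 0)
    (hγmono : MonotoneOn γ (Set.Ici 0)) (hγnn : ∀ t, 0 ≤ t → 0 ≤ γ t)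
    (hγiter : ∀ t, 0 ≤ t → Tendsto (fun n => γ^[n] t) atTop (𝓝 0))
    (hγδ : ∀ s t, 0 ≤ s → 0 ≤ t → |δ s - δ t| ≤ γ |s - t|)
    -- `v : X → [0,∞)` bounded and continuous:
    (v : X → ℝ) (hv : Continuous v) (hvnn : ∀ x, 0 ≤ v x) (hvb : ∃ C, ∀ x, v x ≤ C)
    -- the family of probability measures, weak-* continuous in `x`:
    (ν : X → ProbabilityMeasure A)
    (hν1 : ∀ x, (ν x : Measure A) (Ψ x) = 1)
    (hνcont : Continuous ν) :
    (Continuous (fun x => sSup ((fun a => u (x, a) + δ (v (f (x, a)))) '' Ψ x)) ∧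
      ∃ C, ∀ x, |sSup ((fun a => u (x, a) + δ (v (f (x, a)))) '' Ψ x)| ≤ C) ∧
    (Continuous (fun x =>
        Real.log (∫ a, Real.exp (u (x, a) + δ (v (f (x, a)))) ∂(ν x : Measure A))) ∧
      ∃ C, ∀ x,
        |Real.log (∫ a, Real.exp (u (x, a) + δ (v (f (x, a)))) ∂(ν x : Measure A))| ≤ C) := by
  obtain ⟨Cu, hCu⟩ := hub
  obtain ⟨Cv, hCv⟩ := hvb
  have hG : Continuous (fun p : X × A => u p + δ (v (f p))) :=
    hu.add (hδcont.comp_continuous (hv.comp hf) (fun p => hvnn _))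
  have hG0 : ∀ p : X × A, 0 ≤ u p + δ (v (f p)) := fun p =>
    add_nonneg (hunn p) (hδnn _ (hvnn _))
  have hGM : ∀ p : X × A, u p + δ (v (f p)) ≤ Cu + δ Cv := fun p =>
    add_le_add (hCu p) (hδmono (hvnn _) ((hvnn _).trans (hCv (f p))) (hCv _))
  have hE : ∀ p : X × A, ‖Real.exp (u p + δ (v (f p)))‖ ≤ Real.exp (Cu + δ Cv) := fun p => by
    rw [Real.norm_eq_abs, Real.abs_exp]
    exact Real.exp_le_exp.2 (hGM p)
  have hc2 := aux_int Ψ hΨc hΨne hΨcont (fun p => Real.exp (u p + δ (v (f p))))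
    hG.rexp _ hE ν hν1 hνcont
  have hint : ∀ x, Integrable (fun a => Real.exp (u (x, a) + δ (v (f (x, a)))))
      (ν x : Measure A) := fun x =>
    Integrable.of_bound ((hG.rexp).comp (Continuous.prodMk_right x)).measurable.aestronglyMeasurable
      _ (Eventually.of_forall fun a => hE (x, a))
  have hlow : ∀ x, 1 ≤ ∫ a, Real.exp (u (x, a) + δ (v (f (x, a)))) ∂(ν x : Measure A) := by
    intro x
    have := integral_mono (integrable_const (1 : ℝ)) (hint x)
      (fun a => Real.one_le_exp (hG0 (x, a)))
    simpa using this
  have hup : ∀ x, ∫ a, Real.exp (u (x, a) + δ (v (f (x, a)))) ∂(ν x : Measure A)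
      ≤ Real.exp (Cu + δ Cv) := by
    intro x
    have := integral_mono (hint x) (integrable_const (Real.exp (Cu + δ Cv)))
      (fun a => Real.exp_le_exp.2 (hGM (x, a)))
    simpa using this
  refine ⟨⟨aux_sup Ψ hΨc hΨne hΨcont _ hG _ hGM, Cu + δ Cv, fun x => ?_⟩,
    hc2.log (fun x => by have := hlow x; positivity), Cu + δ Cv, fun x => ?_⟩
  · rw [abs_of_nonneg]
    · apply csSup_le ((hΨne x).image _)
      rintro _ ⟨a, _, rfl⟩
      exact hGM (x, a)
    · apply Real.sSup_nonneg
      rintro _ ⟨a, _, rfl⟩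
      exact hG0 (x, a)
  · rw [abs_of_nonneg (Real.log_nonneg (hlow x))]
    exact (Real.log_le_iff_le_exp (by linarith [hlow x])).2 (hup x)
end

section
/- Let u be nonnegative, bounded and continuous, δ : [0,∞) → [0,∞) a variable discount function with δ(0) = 0, and (ν_x) a family of Borel probability measures on A with ν_x(Ψ(x)) = 1, depending weak-* continuously on x. Then: (a) there is a unique bounded continuous w* : X → [0,∞) with P(w*) = w*, where P(v)(x) = ln ∫_{Ψ(x)} exp(u(x,a) + δ(v(f(x,a)))) dν_x(a); (b) w* ≤ v*, where v* is the unique bounded continuous solution of v*(x) = max_{a ∈ Ψ(x)} [u(x,a) + δ(v*(f(x,a)))]; (c) if for every x one can choose ν_x = δ_{a₀(x)}, the Dirac measure at some a₀(x) ∈ argmax_{a∈Ψ(x)} [u(x,a) + δ(v*(f(x,a)))], then w* = v*. -/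
open Filter Topology MeasureTheory

theorem aux_lt {γ : ℝ → ℝ} (hγmono : MonotoneOn γ (Set.Ici 0)) 
    (hγiter : ∀ t, 0 ≤ t → Tendsto (fun n => γ^[n] t) atTop (𝓝 0)) {t : ℝ} (ht : 0 < t) :
    γ t < t := by
  by_contra! h
  have : ∀ n : ℕ, t ≤ γ^[n] t := by
    intro n
    induction n with
    | zero => simp
    | succ n ih =>
      rw [Function.iterate_succ_apply']
      exact h.trans (hγmono ht.le (ht.le.trans ih) ih)
  have := ge_of_tendsto' (hγiter t ht.le) this
  linarith

theorem aux_fix {E : Type*} [MetricSpace E] [CompleteSpace E] [Nonempty E] {γ : ℝ → ℝ}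
    (hγmono : MonotoneOn γ (Set.Ici 0)) (hγnn : ∀ t, 0 ≤ t → 0 ≤ γ t)
    (hγiter : ∀ t, 0 ≤ t → Tendsto (fun n => γ^[n] t) atTop (𝓝 0)) (T : E → E)
    (hT : ∀ x y, dist (T x) (T y) ≤ γ (dist x y)) :
    ∃ w, T w = w ∧ ∀ w', T w' = w' → w' = w := by
  obtain ⟨x0⟩ := ‹Nonempty E›
  have hlt := fun {t : ℝ} (ht : 0 < t) => aux_lt hγmono hγiter ht
  have hit0 : ∀ t, 0 ≤ t → ∀ n : ℕ, 0 ≤ γ^[n] t := by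
    intro t ht n
    induction n with
    | zero => simpa
    | succ n ih => rw [Function.iterate_succ_apply']; exact hγnn _ ih
  have hball : ∀ ε, 0 < ε → ∀ x y, dist x y ≤ ε → dist (T x) (T y) ≤ γ ε := fun ε hε x y h =>
    (hT x y).trans (hγmono dist_nonneg hε.le h)
  have hd : ∀ n : ℕ, dist (T^[n] x0) (T (T^[n] x0)) ≤ γ^[n] (dist x0 (T x0)) := by
    intro n
    induction n with
    | zero => simp
    | succ n ih =>
      rw [Function.iterate_succ_apply', Function.iterate_succ_apply']
      exact (hT _ _).trans (hγmono dist_nonneg (hit0 _ dist_nonneg n) ih)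
  have hc : CauchySeq (fun n => T^[n] x0) := by
    rw [Metric.cauchySeq_iff']
    intro ε hε
    have hε2 : 0 < ε / 2 := by linarith
    have h1 : 0 < ε / 2 - γ (ε / 2) := by linarith [hlt hε2]
    obtain ⟨N, hN⟩ := ((hγiter (dist x0 (T x0)) dist_nonneg).eventually (gt_mem_nhds h1)).exists
    refine ⟨N, fun n hn => ?_⟩
    have : dist (T^[n] x0) (T^[N] x0) ≤ ε / 2 := by
      induction n, hn using Nat.le_induction with
      | base => simp [hε2.le]
      | succ n hn ih =>
        rw [Function.iterate_succ_apply']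
        have h2 := hball _ hε2 _ _ ih
        have h3 := hd N
        have h4 := dist_triangle (T (T^[n] x0)) (T (T^[N] x0)) (T^[N] x0)
        rw [dist_comm (T (T^[N] x0))] at h4
        linarith
    linarith
  have hcont : Continuous T := by
    rw [Metric.continuous_iff]
    intro b ε hε
    exact ⟨ε, hε, fun a h => (hball ε hε _ _ h.le).trans_lt (hlt hε)⟩
  obtain ⟨w, hw⟩ := cauchySeq_tendsto_of_complete hc
  have hfix : T w = w := isFixedPt_of_tendsto_iterate hw hcont.continuousAt
  refine ⟨w, hfix, fun w' hw' => ?_⟩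
  by_contra hne
  have hp := dist_pos.2 hne
  have h1 := hT w' w
  rw [hfix, hw'] at h1
  linarith [hlt hp]

theorem aux_int_s8 {A : Type*} [MetricSpace A] [MeasurableSpace A] [BorelSpace A]
    (μ : Measure A) [IsProbabilityMeasure μ] {F : A → ℝ} (hF : Continuous F) {C : ℝ}
    (hC : ∀ a, F a ≤ C) : Integrable (fun a => Real.exp (F a)) μ := by
  refine Integrable.of_bound (C := Real.exp C) 
    (Real.continuous_exp.comp hF).measurable.aestronglyMeasurable (.of_forall fun a => ?_)
  rw [Real.norm_eq_abs, abs_of_pos (Real.exp_pos _)]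
  exact Real.exp_le_exp.2 (hC a)

theorem aux_log {A : Type*} [MetricSpace A] [MeasurableSpace A] [BorelSpace A]
    (μ : Measure A) [IsProbabilityMeasure μ] {F G : A → ℝ} (hF : Continuous F) (hG : Continuous G)
    {C D K : ℝ} (hC : ∀ a, F a ≤ C) (hD : ∀ a, G a ≤ D) (h : ∀ᵐ a ∂μ, F a ≤ G a + K) :
    Real.log (∫ a, Real.exp (F a) ∂μ) ≤ Real.log (∫ a, Real.exp (G a) ∂μ) + K := by
  have iF := aux_int_s8 μ hF hC
  have iG := aux_int_s8 μ hG hD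
  rw [← Real.log_exp K, ← Real.log_mul (integral_exp_pos iG).ne' (Real.exp_pos _).ne',
    ← integral_mul_const]
  refine Real.log_le_log (integral_exp_pos iF) (integral_mono_ae iF (iG.mul_const _) ?_)
  filter_upwards [h] with a ha
  rw [← Real.exp_add]
  exact Real.exp_le_exp.2 ha

theorem aux_cont {X A : Type*} [MetricSpace X] [MetricSpace A]
    [MeasurableSpace A] [BorelSpace A]
    (Ψ : X → Set A) (hΨc : ∀ x, IsCompact (Ψ x)) (hΨne : ∀ x, (Ψ x).Nonempty)
    (hΨcont : Continuous fun x =>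
      (⟨⟨Ψ x, hΨc x⟩, hΨne x⟩ : TopologicalSpace.NonemptyCompacts A))
    (ν : X → ProbabilityMeasure A)
    (hν1 : ∀ x, (ν x : Measure A) (Ψ x) = 1)
    (hνcont : Continuous ν) (g : X × A → ℝ) (hg : Continuous g) {C : ℝ} (hC : ∀ p, |g p| ≤ C) :
    Continuous fun x => ∫ a, g (x, a) ∂(ν x : Measure A) := by
  have hint : ∀ x y, Integrable (fun a => g (x, a)) (ν y : Measure A) := fun x y =>
    Integrable.of_bound (C := C) 
      (hg.comp (by fun_prop : Continuous fun a => (x, a))).measurable.aestronglyMeasurable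
      (.of_forall fun a => hC _)
  rw [continuous_iff_continuousAt]
  intro x
  have h2 : Tendsto (fun y => ∫ a, g (x, a) ∂(ν y : Measure A)) (𝓝 x)
      (𝓝 (∫ a, g (x, a) ∂(ν x : Measure A))) := by
    exact (ProbabilityMeasure.tendsto_iff_forall_integral_tendsto.1 (hνcont.tendsto x))
      (BoundedContinuousFunction.ofNormedAddCommGroup (fun a => g (x, a)) (by fun_prop) C
        (fun a => hC _))
  rw [ContinuousAt, Metric.tendsto_nhds]
  intro ε hε
  have hε2 : 0 < ε / 2 := by linarith
  have hO : IsOpen {p : X × A | |g p - g (x, p.2)| < ε / 2} :=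
    isOpen_lt (by fun_prop) continuous_const
  obtain ⟨V, W, hV, hW, hxV, hKW, hVW⟩ := generalized_tube_lemma (isCompact_singleton (x := x))
    (hΨc x) hO (by rintro ⟨y, a⟩ ⟨hy, ha⟩; simp at hy; subst hy; simpa using hε)
  have h3 : ∀ᶠ y in 𝓝 x, Ψ y ⊆ W :=
    ((TopologicalSpace.NonemptyCompacts.isOpen_subsets_of_isOpen hW).preimage hΨcont).mem_nhds hKW
  filter_upwards [h3, hV.mem_nhds (hxV rfl), (Metric.tendsto_nhds.1 h2) _ hε2] with y hy hyV hy2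
  have h4 : ‖∫ a, (g (y, a) - g (x, a)) ∂(ν y : Measure A)‖ ≤ ε / 2 * (ν y : Measure A).real Set.univ := by
    refine norm_integral_le_of_norm_le_const ?_
    have : ∀ᵐ a ∂(ν y : Measure A), a ∈ Ψ y :=
      (mem_ae_iff_prob_eq_one (hΨc y).measurableSet).2 (hν1 y)
    filter_upwards [this] with a ha
    have : (y, a) ∈ V ×ˢ W := ⟨hyV, hy ha⟩
    exact (hVW this).le
  rw [integral_sub (hint _ _) (hint _ _), probReal_univ, mul_one, ← dist_eq_norm] at h4
  linarith [dist_triangle (∫ a, g (y, a) ∂(ν y : Measure A)) (∫ a, g (x, a) ∂(ν y : Measure A)) (∫ a, g (x, a) ∂(ν x : Measure A))]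


/-- Let `u` be nonnegative, bounded and continuous, `δ` a variable discount
function with `δ(0) = 0`, and `(ν_x)` a weak-* continuous family of Borel probability measures
on `A` with `ν_x(Ψ(x)) = 1`.  Then:
(a) there is a unique bounded continuous `w* : X → [0,∞)` with `P(w*) = w*`, where
`P(v)(x) = ln ∫ exp(u(x,a) + δ(v(f(x,a)))) dν_x(a)`;
(b) `w* ≤ v*`, where `v*` is the unique bounded continuous solution of the discounted
Bellman equation;
(c) if `ν_x` is the Dirac measure at some `a₀(x) ∈ argmax_{a ∈ Ψ(x)} [u(x,a) + δ(v*(f(x,a)))]`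
for every `x`, then `w* = v*`. -/
theorem transfer_unique_fixed_point
    {X A : Type*} [MetricSpace X] [CompleteSpace X] [MetricSpace A]
    [MeasurableSpace A] [BorelSpace A]
    (Ψ : X → Set A) (f : X × A → X) (u : X × A → ℝ) (δ γ : ℝ → ℝ)
    (hΨc : ∀ x, IsCompact (Ψ x)) (hΨne : ∀ x, (Ψ x).Nonempty)
    (hΨcont : Continuous fun x =>
      (⟨⟨Ψ x, hΨc x⟩, hΨne x⟩ : TopologicalSpace.NonemptyCompacts A))
    (hf : Continuous f) (hu : Continuous u)
    (hunn : ∀ p, 0 ≤ u p) (hub : ∃ C, ∀ p, u p ≤ C)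
    -- `δ` is a variable discount function with `δ 0 = 0` and modulus of contraction `γ`:
    (hδcont : ContinuousOn δ (Set.Ici 0)) (hδmono : MonotoneOn δ (Set.Ici 0))
    (hδnn : ∀ t, 0 ≤ t → 0 ≤ δ t) (hδ0 : δ 0 = 0)
    (hγmono : MonotoneOn γ (Set.Ici 0)) (hγnn : ∀ t, 0 ≤ t → 0 ≤ γ t)
    (hγiter : ∀ t, 0 ≤ t → Tendsto (fun n => γ^[n] t) atTop (𝓝 0))
    (hγδ : ∀ s t, 0 ≤ s → 0 ≤ t → |δ s - δ t| ≤ γ |s - t|)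
    -- the family of probability measures, weak-* continuous in `x`:
    (ν : X → ProbabilityMeasure A)
    (hν1 : ∀ x, (ν x : Measure A) (Ψ x) = 1)
    (hνcont : Continuous ν) :
    ∃ w : X → ℝ,
      -- (a) existence and uniqueness of the bounded continuous fixed point of `P`:
      Continuous w ∧ (∃ C, ∀ x, |w x| ≤ C) ∧ (∀ x, 0 ≤ w x) ∧
      (∀ x, w x =
        Real.log (∫ a, Real.exp (u (x, a) + δ (w (f (x, a)))) ∂(ν x : Measure A))) ∧
      (∀ w' : X → ℝ, Continuous w' → (∃ C, ∀ x, |w' x| ≤ C) → (∀ x, 0 ≤ w' x) →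
        (∀ x, w' x =
          Real.log (∫ a, Real.exp (u (x, a) + δ (w' (f (x, a)))) ∂(ν x : Measure A))) →
        w' = w) ∧
      -- with respect to the unique bounded continuous Bellman solution `v*`:
      ∀ v : X → ℝ, Continuous v → (∃ C, ∀ x, |v x| ≤ C) → (∀ x, 0 ≤ v x) →
        (∀ x, v x = sSup ((fun a => u (x, a) + δ (v (f (x, a)))) '' Ψ x)) →
        -- (b) `w* ≤ v*`:
        (∀ x, w x ≤ v x) ∧
        -- (c) the Dirac/argmax case gives `w* = v*`:
        (∀ a₀ : X → A, (∀ x, a₀ x ∈ Ψ x) →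
          (∀ x, ∀ a ∈ Ψ x,
            u (x, a) + δ (v (f (x, a))) ≤ u (x, a₀ x) + δ (v (f (x, a₀ x)))) →
          (∀ x, (ν x : Measure A) = Measure.dirac (a₀ x)) → w = v) := by
  obtain ⟨B, hB⟩ := hub
  have hδ'c : Continuous fun t => δ (max t 0) :=
    hδcont.comp_continuous (by fun_prop) (fun t => Set.mem_Ici.2 (le_max_right _ _))
  have hδ'γ : ∀ s t r, |s - t| ≤ r → |δ (max s 0) - δ (max t 0)| ≤ γ r := by
    intro s t r h
    refine (hγδ _ _ (le_max_right _ _) (le_max_right _ _)).trans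
      (hγmono (Set.mem_Ici.2 (abs_nonneg _)) (Set.mem_Ici.2 ((abs_nonneg _).trans h)) ?_)
    exact (abs_max_sub_max_le_abs s t 0).trans h
  -- the integrand for bounded continuous `v`
  have hFc : ∀ v : X → ℝ, Continuous v →
      Continuous fun p : X × A => u p + δ (max (v (f p)) 0) := fun v hv =>
    hu.add (hδ'c.comp (hv.comp hf))
  have hFb : ∀ (v : X → ℝ) (c : ℝ), (∀ x, |v x| ≤ c) → ∀ p : X × A, 
      u p + δ (max (v (f p)) 0) ≤ B + δ (max c 0) := fun v c hc p =>
    add_le_add (hB p) (hδmono (Set.mem_Ici.2 (le_max_right _ _)) (Set.mem_Ici.2 (le_max_right _ _))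
      (max_le_max ((le_abs_self _).trans (hc _)) le_rfl))
  have hF0 : ∀ (v : X → ℝ) (p : X × A), 0 ≤ u p + δ (max (v (f p)) 0) := fun v p =>
    add_nonneg (hunn p) (hδnn _ (le_max_right _ _))
  have hslice : ∀ v : X → ℝ, Continuous v → ∀ x,
      Continuous fun a : A => u (x, a) + δ (max (v (f (x, a))) 0) := fun v hv x =>
    (hFc v hv).comp (by fun_prop : Continuous fun a : A => (x, a))
  let P : (X → ℝ) → X → ℝ := fun v x =>
    Real.log (∫ a, Real.exp (u (x, a) + δ (max (v (f (x, a))) 0)) ∂(ν x : Measure A))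
  have hP0 : ∀ v : X → ℝ, Continuous v → ∀ c, (∀ x, |v x| ≤ c) → ∀ x, 0 ≤ P v x := by
    intro v hv c hc x
    have := aux_log (ν x : Measure A) (F := fun _ => 0) (C := 0) (K := 0) continuous_const
      (hslice v hv x) (fun _ => le_rfl) (fun a => hFb v c hc (x, a))
      (.of_forall fun a => by simpa using hF0 v (x, a))
    simpa using this
  have hPb : ∀ v : X → ℝ, Continuous v → ∀ c, (∀ x, |v x| ≤ c) → ∀ x,
      P v x ≤ B + δ (max c 0) := by
    intro v hv c hc x
    have := aux_log (ν x : Measure A) (G := fun _ => 0) (D := 0) (K := B + δ (max c 0))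
      (hslice v hv x) continuous_const (fun a => hFb v c hc (x, a)) (fun _ => le_rfl) 
      (.of_forall fun a => by simpa using hFb v c hc (x, a))
    simpa using this
  have hPc : ∀ v : X → ℝ, Continuous v → ∀ c, (∀ x, |v x| ≤ c) → Continuous (P v) := by
    intro v hv c hc
    refine Continuous.log (aux_cont Ψ hΨc hΨne hΨcont ν hν1 hνcont
      (fun p => Real.exp (u p + δ (max (v (f p)) 0))) (Real.continuous_exp.comp (hFc v hv))
      (C := Real.exp (B + δ (max c 0))) fun p => ?_) fun x => ?_
    · rw [abs_of_pos (Real.exp_pos _)]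
      exact Real.exp_le_exp.2 (hFb v c hc p)
    · exact (integral_exp_pos (aux_int_s8 _ (hslice v hv x) fun a => hFb v c hc (x, a))).ne'
  let T : BoundedContinuousFunction X ℝ → BoundedContinuousFunction X ℝ := fun v =>
    BoundedContinuousFunction.ofNormedAddCommGroup (P v)
      (hPc v v.continuous ‖v‖ v.norm_coe_le_norm) (B + δ (max ‖v‖ 0)) (fun x => by
        rw [Real.norm_eq_abs, abs_of_nonneg (hP0 v v.continuous ‖v‖ v.norm_coe_le_norm x)]
        exact hPb v v.continuous ‖v‖ v.norm_coe_le_norm x)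
  have hTdef : ∀ v x, T v x = P v x := fun v x => rfl
  have hT1 : ∀ v w x, T v x ≤ T w x + γ (dist v w) := by
    intro v w x
    refine aux_log (ν x : Measure A) (hslice v v.continuous x) (hslice w w.continuous x)
      (fun a => hFb v ‖v‖ v.norm_coe_le_norm (x, a))
      (fun a => hFb w ‖w‖ w.norm_coe_le_norm (x, a)) (.of_forall fun a => ?_)
    have := hδ'γ (v (f (x, a))) (w (f (x, a))) (dist v w)
      (by rw [← Real.dist_eq]; exact BoundedContinuousFunction.dist_coe_le_dist _)
    linarith [(abs_le.1 this).2]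
  obtain ⟨w, hw, huniq⟩ := aux_fix hγmono hγnn hγiter T (fun v w => by
    rw [BoundedContinuousFunction.dist_le (hγnn _ dist_nonneg)]
    intro x
    rw [Real.dist_eq, abs_le]
    have h1 := hT1 v w x
    have h2 := hT1 w v x
    rw [dist_comm w v] at h2
    constructor <;> linarith)
  have hwP : ∀ x, w x = P w x := fun x => by rw [← hTdef, hw]
  have hw0 : ∀ x, 0 ≤ w x := fun x => by
    rw [hwP]; exact hP0 w w.continuous ‖w‖ w.norm_coe_le_norm x
  have hPeq : ∀ v : X → ℝ, (∀ x, 0 ≤ v x) → ∀ x, P v x =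
      Real.log (∫ a, Real.exp (u (x, a) + δ (v (f (x, a)))) ∂(ν x : Measure A)) := by
    intro v hv x
    simp only [P, max_eq_left (hv _)]
  have huniq' : ∀ w' : X → ℝ, Continuous w' → (∃ C, ∀ x, |w' x| ≤ C) → (∀ x, 0 ≤ w' x) →
        (∀ x, w' x =
          Real.log (∫ a, Real.exp (u (x, a) + δ (w' (f (x, a)))) ∂(ν x : Measure A))) →
        w' = w := by
    intro w' hc ⟨C, hC⟩ h0 hfix
    have := huniq (BoundedContinuousFunction.ofNormedAddCommGroup w' hc C hC) (by
      ext x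
      rw [hTdef]
      exact (hPeq w' h0 x).trans (hfix x).symm)
    rw [← this]; rfl
  refine ⟨w, w.continuous, ⟨‖w‖, w.norm_coe_le_norm⟩, hw0,
    fun x => (hwP x).trans (hPeq w hw0 x), huniq', ?_⟩
  intro v hv ⟨c, hc⟩ hv0 hbell
  have hmax : ∀ x : X, ∀ a ∈ Ψ x, u (x, a) + δ (max (v (f (x, a))) 0) ≤ v x := by
    intro x a ha
    rw [hbell x]
    have h1 := ((hΨc x).image (hslice v hv x)).bddAbove
    simp only [max_eq_left (hv0 _)] at h1 ⊢
    exact le_csSup h1 ⟨a, ha, rfl⟩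
  constructor
  · have key : ∀ K, 0 ≤ K → (∀ x, w x ≤ v x + K) → ∀ x, w x ≤ v x + γ K := by
      intro K hK h x
      rw [hwP x]
      have := aux_log (ν x : Measure A) (G := fun _ => v x) (D := v x) (K := γ K)
        (hslice w w.continuous x) continuous_const
        (fun a => hFb w ‖w‖ w.norm_coe_le_norm (x, a)) (fun _ => le_rfl) (by
          have hae : ∀ᵐ a ∂(ν x : Measure A), a ∈ Ψ x :=
            (mem_ae_iff_prob_eq_one (hΨc x).measurableSet).2 (hν1 x)
          filter_upwards [hae] with a ha
          have h1 := hmax x a ha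
          have h2 : δ (max (w (f (x, a))) 0) ≤ δ (max (v (f (x, a))) 0) + γ K := by
            rcases le_total (w (f (x, a))) (v (f (x, a))) with h3 | h3
            · have := hδmono (le_max_right (w (f (x, a))) 0) (le_max_right (v (f (x, a))) 0)
                (max_le_max h3 le_rfl)
              linarith [hγnn K hK]
            · have := hδ'γ (w (f (x, a))) (v (f (x, a))) K
                (by rw [abs_of_nonneg (by linarith)]; linarith [h (f (x, a))])
              linarith [(abs_le.1 this).2]
          linarith)
      simpa using this
    have hiter : ∀ n : ℕ, 0 ≤ γ^[n] ‖w‖ ∧ ∀ x, w x ≤ v x + γ^[n] ‖w‖ := by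
      intro n
      induction n with
      | zero =>
        refine ⟨norm_nonneg _, fun x => ?_⟩
        have := (le_abs_self _).trans (w.norm_coe_le_norm x)
        simp only [Function.iterate_zero, id]
        linarith [hv0 x]
      | succ n ih =>
        rw [Function.iterate_succ_apply']
        exact ⟨hγnn _ ih.1, key _ ih.1 ih.2⟩
    intro x
    have := (hγiter ‖w‖ (norm_nonneg _)).const_add (v x)
    rw [add_zero] at this
    exact ge_of_tendsto' this fun n => (hiter n).2 x
  · intro a₀ ha₀ hopt hdir
    refine (huniq' v hv ⟨c, hc⟩ hv0 fun x => ?_).symm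
    rw [hdir x, integral_dirac, Real.log_exp, hbell x]
    refine IsGreatest.csSup_eq ⟨⟨a₀ x, ha₀ x, rfl⟩, ?_⟩
    rintro _ ⟨a, ha, rfl⟩
    exact hopt x a ha
end

section
/- (Monotonicity in the discount) Let δ₁ ≤ δ₂ pointwise be two variable discount functions on [0,∞) with δ_j(0) = 0, and let u be nonnegative, bounded and continuous. If v₁, v₂ are the unique bounded continuous solutions of v_j(x) = max_{a ∈ Ψ(x)} [u(x,a) + δ_j(v_j(f(x,a)))] for j = 1, 2, then v₁ ≤ v₂. The same holds for the fixed points of the corresponding discounted transfer operators P_j(v)(x) = ln ∫_{Ψ(x)} exp(u(x,a) + δ_j(v(f(x,a)))) dν_x(a). -/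
open Filter Topology MeasureTheory

theorem aux_step (δ₁ δ₂ γ₂ : ℝ → ℝ) (hδ₂mono : MonotoneOn δ₂ (Set.Ici 0))
    (hγ₂mono : MonotoneOn γ₂ (Set.Ici 0))
    (hγ₂δ : ∀ s t, 0 ≤ s → 0 ≤ t → |δ₂ s - δ₂ t| ≤ γ₂ |s - t|)
    (hle : ∀ t, 0 ≤ t → δ₁ t ≤ δ₂ t) (s t d : ℝ) (hs : 0 ≤ s) (ht : 0 ≤ t) (hd : 0 ≤ d)
    (h : s ≤ t + d) : δ₁ s ≤ δ₂ t + γ₂ d := by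
  have h1 := hle s hs
  have hm : 0 ≤ max s t := le_max_of_le_left hs
  have h2 : δ₂ s ≤ δ₂ (max s t) := hδ₂mono hs hm (le_max_left _ _)
  have h3 := le_trans (le_abs_self _) (hγ₂δ (max s t) t hm ht)
  have h4 : γ₂ |max s t - t| ≤ γ₂ d := by
    apply hγ₂mono (Set.mem_Ici.2 (abs_nonneg _)) (Set.mem_Ici.2 hd)
    rw [abs_of_nonneg (sub_nonneg.2 (le_max_right _ _))]
    rcases max_cases s t with ⟨h, _⟩ | ⟨h, _⟩ <;> rw [h] <;> linarith
  linarith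

theorem aux_iter {X : Type*} (p q : X → ℝ) (γ : ℝ → ℝ) (hγnn : ∀ t, 0 ≤ t → 0 ≤ γ t)
    (hγiter : ∀ t, 0 ≤ t → Tendsto (fun n => γ^[n] t) atTop (𝓝 0))
    (hpb : ∃ C, ∀ x, |p x| ≤ C) (hq : ∀ x, 0 ≤ q x)
    (hstep : ∀ d, 0 ≤ d → (∀ x, p x ≤ q x + d) → ∀ x, p x ≤ q x + γ d) (x : X) :
    p x ≤ q x := by
  obtain ⟨C, hC⟩ := hpb
  have hC0 : 0 ≤ C := (abs_nonneg _).trans (hC x)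
  have key : ∀ n, 0 ≤ γ^[n] C ∧ ∀ x, p x ≤ q x + γ^[n] C := by
    intro n
    induction n with
    | zero =>
      refine ⟨hC0, fun y => ?_⟩
      have := (le_abs_self _).trans (hC y)
      have := hq y
      simp only [Function.iterate_zero, id]
      linarith
    | succ k ih =>
      rw [Function.iterate_succ_apply']
      exact ⟨hγnn _ ih.1, hstep _ ih.1 ih.2⟩
  have hl : Tendsto (fun n => q x + γ^[n] C) atTop (𝓝 (q x + 0)) :=
    tendsto_const_nhds.add (hγiter C hC0)
  rw [add_zero] at hl
  exact ge_of_tendsto' hl fun n => (key n).2 x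

/-- **Monotonicity in the discount.** Let `δ₁ ≤ δ₂` (pointwise on `[0,∞)`) be
two variable discount functions with `δ_j(0) = 0`, and let `u` be nonnegative, bounded and
continuous.  If `v₁, v₂` are the unique bounded continuous solutions of the respective
discounted Bellman equations, then `v₁ ≤ v₂`; the same holds for the fixed points `w₁, w₂` of
the corresponding discounted transfer operators. -/
theorem monotonicity_in_discount
    {X A : Type*} [MetricSpace X] [CompleteSpace X] [MetricSpace A]
    [MeasurableSpace A] [BorelSpace A]
    (Ψ : X → Set A) (f : X × A → X) (u : X × A → ℝ) (δ₁ δ₂ γ₁ γ₂ : ℝ → ℝ)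
    (hΨc : ∀ x, IsCompact (Ψ x)) (hΨne : ∀ x, (Ψ x).Nonempty)
    (hΨcont : Continuous fun x =>
      (⟨⟨Ψ x, hΨc x⟩, hΨne x⟩ : TopologicalSpace.NonemptyCompacts A))
    (hf : Continuous f) (hu : Continuous u)
    (hunn : ∀ p, 0 ≤ u p) (hub : ∃ C, ∀ p, u p ≤ C)
    -- `δ₁` is a variable discount function with `δ₁ 0 = 0` and modulus `γ₁`:
    (hδ₁cont : ContinuousOn δ₁ (Set.Ici 0)) (hδ₁mono : MonotoneOn δ₁ (Set.Ici 0))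
    (hδ₁nn : ∀ t, 0 ≤ t → 0 ≤ δ₁ t) (hδ₁0 : δ₁ 0 = 0)
    (hγ₁mono : MonotoneOn γ₁ (Set.Ici 0)) (hγ₁nn : ∀ t, 0 ≤ t → 0 ≤ γ₁ t)
    (hγ₁iter : ∀ t, 0 ≤ t → Tendsto (fun n => γ₁^[n] t) atTop (𝓝 0))
    (hγ₁δ : ∀ s t, 0 ≤ s → 0 ≤ t → |δ₁ s - δ₁ t| ≤ γ₁ |s - t|)
    -- `δ₂` is a variable discount function with `δ₂ 0 = 0` and modulus `γ₂`:
    (hδ₂cont : ContinuousOn δ₂ (Set.Ici 0)) (hδ₂mono : MonotoneOn δ₂ (Set.Ici 0))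
    (hδ₂nn : ∀ t, 0 ≤ t → 0 ≤ δ₂ t) (hδ₂0 : δ₂ 0 = 0)
    (hγ₂mono : MonotoneOn γ₂ (Set.Ici 0)) (hγ₂nn : ∀ t, 0 ≤ t → 0 ≤ γ₂ t)
    (hγ₂iter : ∀ t, 0 ≤ t → Tendsto (fun n => γ₂^[n] t) atTop (𝓝 0))
    (hγ₂δ : ∀ s t, 0 ≤ s → 0 ≤ t → |δ₂ s - δ₂ t| ≤ γ₂ |s - t|)
    -- the discounts are pointwise ordered on `[0,∞)`:
    (hle : ∀ t, 0 ≤ t → δ₁ t ≤ δ₂ t)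
    -- the family of probability measures, weak-* continuous in `x`:
    (ν : X → ProbabilityMeasure A)
    (hν1 : ∀ x, (ν x : Measure A) (Ψ x) = 1)
    (hνcont : Continuous ν)
    -- `v₁, v₂` are the (unique) bounded continuous solutions of the Bellman equations:
    (v₁ v₂ : X → ℝ)
    (hv₁c : Continuous v₁) (hv₁b : ∃ C, ∀ x, |v₁ x| ≤ C) (hv₁nn : ∀ x, 0 ≤ v₁ x)
    (hv₁fix : ∀ x, v₁ x = sSup ((fun a => u (x, a) + δ₁ (v₁ (f (x, a)))) '' Ψ x))
    (hv₂c : Continuous v₂) (hv₂b : ∃ C, ∀ x, |v₂ x| ≤ C) (hv₂nn : ∀ x, 0 ≤ v₂ x)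
    (hv₂fix : ∀ x, v₂ x = sSup ((fun a => u (x, a) + δ₂ (v₂ (f (x, a)))) '' Ψ x))
    -- `w₁, w₂` are the (unique) bounded continuous fixed points of the transfer operators:
    (w₁ w₂ : X → ℝ)
    (hw₁c : Continuous w₁) (hw₁b : ∃ C, ∀ x, |w₁ x| ≤ C) (hw₁nn : ∀ x, 0 ≤ w₁ x)
    (hw₁fix : ∀ x, w₁ x =
      Real.log (∫ a, Real.exp (u (x, a) + δ₁ (w₁ (f (x, a)))) ∂(ν x : Measure A)))
    (hw₂c : Continuous w₂) (hw₂b : ∃ C, ∀ x, |w₂ x| ≤ C) (hw₂nn : ∀ x, 0 ≤ w₂ x)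
    (hw₂fix : ∀ x, w₂ x =
      Real.log (∫ a, Real.exp (u (x, a) + δ₂ (w₂ (f (x, a)))) ∂(ν x : Measure A))) :
    (∀ x, v₁ x ≤ v₂ x) ∧ (∀ x, w₁ x ≤ w₂ x) := by
  have step := aux_step δ₁ δ₂ γ₂ hδ₂mono hγ₂mono hγ₂δ hle
  constructor
  · refine aux_iter v₁ v₂ γ₂ hγ₂nn hγ₂iter hv₁b hv₂nn fun d hd h x => ?_
    rw [hv₁fix x]
    refine csSup_le ((hΨne x).image _) ?_
    rintro _ ⟨a, ha, rfl⟩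
    have hc : Continuous fun a => u (x, a) + δ₂ (v₂ (f (x, a))) :=
      (hu.comp (by fun_prop)).add
        (hδ₂cont.comp_continuous (hv₂c.comp (hf.comp (by fun_prop))) fun a => hv₂nn _)
    have h1 : u (x, a) + δ₂ (v₂ (f (x, a))) ≤ v₂ x := by
      rw [hv₂fix x]
      exact le_csSup ((hΨc x).image hc).bddAbove ⟨a, ha, rfl⟩
    have h2 := step _ _ d (hv₁nn (f (x, a))) (hv₂nn (f (x, a))) hd (h _)
    simp only
    linarith
  · refine aux_iter w₁ w₂ γ₂ hγ₂nn hγ₂iter hw₁b hw₂nn fun d hd h x => ?_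
    obtain ⟨C, hC⟩ := hub
    have hc (δ : ℝ → ℝ) (w : X → ℝ) (hδ : ContinuousOn δ (Set.Ici 0))
        (hm : MonotoneOn δ (Set.Ici 0)) (hw : Continuous w) (hn : ∀ x, 0 ≤ w x)
        (hb : ∃ C, ∀ x, |w x| ≤ C) :
        Integrable (fun a => Real.exp (u (x, a) + δ (w (f (x, a))))) (ν x : Measure A) := by
      obtain ⟨B, hB⟩ := hb
      have hc : Continuous fun a => Real.exp (u (x, a) + δ (w (f (x, a)))) :=
        Real.continuous_exp.comp ((hu.comp (by fun_prop)).add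
          (hδ.comp_continuous (hw.comp (hf.comp (by fun_prop))) fun a => hn _))
      refine Integrable.of_bound hc.measurable.aestronglyMeasurable (Real.exp (C + δ B)) ?_
      refine Eventually.of_forall fun a => ?_
      rw [Real.norm_eq_abs, Real.abs_exp]
      have hwB := (le_abs_self _).trans (hB (f (x, a)))
      exact Real.exp_le_exp.2 (add_le_add (hC _) (hm (hn _) ((hn _).trans hwB) hwB))
    have i1 := hc δ₁ w₁ hδ₁cont hδ₁mono hw₁c hw₁nn hw₁b
    have i2 := hc δ₂ w₂ hδ₂cont hδ₂mono hw₂c hw₂nn hw₂b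
    have p1 := integral_exp_pos i1
    have p2 := integral_exp_pos i2
    rw [hw₁fix x, hw₂fix x, ← Real.log_exp (γ₂ d), ← Real.log_mul p2.ne' (Real.exp_pos _).ne',
      ← integral_mul_const]
    refine Real.log_le_log p1 (integral_mono i1 (i2.mul_const _) fun a => ?_)
    simp only
    rw [← Real.exp_add]
    have h2 := step _ _ d (hw₁nn (f (x, a))) (hw₂nn (f (x, a))) hd (h _)
    exact Real.exp_le_exp.2 (by linarith)
end
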